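/- Let U ⊆ ℂ be a nonempty connected open set and let f₁, …, f_a (a ≥ 2) be functions analytic on U. Suppose the Wronskian W(f₁, …, f_{a−1}) is not identically zero on U, while the Wronskian W(f₁, …, f_a) is identically zero on U. Then there exist constants c₁, …, c_{a−1} ∈ ℂ such that f_a = c₁f₁ + ⋯ + c_{a−1}f_{a−1} on U. -/

import Mathlib

open Matrix

theorem DifferentiableAt.matrix_det {n : Type*} [Fintype n] [DecidableEq n]
    {M : ℂ → Matrix n n ℂ} {t : ℂ} (hM : ∀ i j, DifferentiableAt ℂ (fun s => M s i j) t) :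
    DifferentiableAt ℂ (fun s => (M s).det) t := by
  simp only [Matrix.det_apply]
  fun_prop

/-- If the coefficients of a pointwise linear relation also satisfy the relation between the
derivatives, and the system is nondegenerate, then the coefficients have derivative zero. -/
theorem deriv_coeff_eq_zero {n : ℕ} {M : ℂ → Matrix (Fin n) (Fin n) ℂ} {c F : ℂ → Fin n → ℂ}
    {t : ℂ} (hM : ∀ i j, DifferentiableAt ℂ (fun s => M s i j) t)
    (hc : ∀ j, DifferentiableAt ℂ (fun s => c s j) t)
    (hrel : ∀ᶠ s in nhds t, M s *ᵥ c s = F s)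
    (hrel' : ∀ i, ∑ j, deriv (fun s => M s i j) t * c t j = deriv (fun s => F s i) t)
    (hdet : (M t).det ≠ 0) (j : Fin n) : deriv (fun s => c s j) t = 0 := by
  have key : M t *ᵥ (fun j => deriv (fun s => c s j) t) = 0 := by
    ext i
    have h1 : (fun s => F s i) =ᶠ[nhds t] fun s => ∑ j, M s i j * c s j := by
      filter_upwards [hrel] with s hs
      rw [← hs]; rfl
    have h2 : HasDerivAt (fun s => ∑ j, M s i j * c s j)
        (∑ j, (deriv (fun s => M s i j) t * c t j + M t i j * deriv (fun s => c s j) t)) t :=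
      HasDerivAt.fun_sum fun j _ => (hM i j).hasDerivAt.mul (hc j).hasDerivAt
    have h3 := h1.deriv_eq
    rw [h2.deriv, Finset.sum_add_distrib, hrel' i] at h3
    simpa [Matrix.mulVec, dotProduct] using h3
  exact congrFun (Matrix.eq_zero_of_mulVec_eq_zero hdet key) j

/-- If the square matrix `A` is singular and its leading principal block is not, then the last
column of `A` is a combination of the others, with coefficients determined by the block. -/
theorem Matrix.sum_mul_eq_last_of_det_eq_zero {n : ℕ} {A : Matrix (Fin (n + 1)) (Fin (n + 1)) ℂ}
    (hA : A.det = 0) (hB : (A.submatrix Fin.castSucc Fin.castSucc).det ≠ 0) {c : Fin n → ℂ}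
    (hc : ∀ i : Fin n, ∑ j : Fin n, A i.castSucc j.castSucc * c j = A i.castSucc (Fin.last n))
    (i : Fin (n + 1)) : ∑ j : Fin n, A i j.castSucc * c j = A i (Fin.last n) := by
  obtain ⟨v, hv0, hv⟩ := Matrix.exists_mulVec_eq_zero_iff.mpr hA
  have hrow : ∀ i, ∑ j : Fin n, A i j.castSucc * v j.castSucc
      + A i (Fin.last n) * v (Fin.last n) = 0 := fun i => by
    simpa [Matrix.mulVec, dotProduct, Fin.sum_univ_castSucc] using congrFun hv i
  have hcomb : (fun j : Fin n => v j.castSucc + v (Fin.last n) * c j) = 0 := by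
    refine Matrix.eq_zero_of_mulVec_eq_zero hB (funext fun i => ?_)
    simp only [Matrix.mulVec, dotProduct, Matrix.submatrix_apply, mul_add, Finset.sum_add_distrib,
      Pi.zero_apply]
    rw [← hrow i.castSucc, ← hc i, Finset.sum_mul]
    congr 1
    exact Finset.sum_congr rfl fun j _ => by ring
  have hvj : ∀ j : Fin n, v j.castSucc = -(v (Fin.last n) * c j) := fun j =>
    eq_neg_of_add_eq_zero_left (congrFun hcomb j)
  have hlast : v (Fin.last n) ≠ 0 := by
    intro h
    refine hv0 (funext fun i => ?_)
    induction i using Fin.lastCases with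
    | last => exact h
    | cast j => simp [hvj, h]
  have h := hrow i
  have hsum : ∑ j : Fin n, A i j.castSucc * v j.castSucc
      = -(v (Fin.last n) * ∑ j : Fin n, A i j.castSucc * c j) := by
    rw [Finset.mul_sum, ← Finset.sum_neg_distrib]
    exact Finset.sum_congr rfl fun j _ => by rw [hvj]; ring
  rw [hsum] at h
  exact mul_left_cancel₀ hlast (by linear_combination -h)

theorem exists_coeff_of_wronskian_eq_zero {U : Set ℂ} (hUo : IsOpen U) (hUc : IsPreconnected U)
    {n : ℕ} {f : Fin (n + 1) → ℂ → ℂ} (hf : ∀ j, AnalyticOnNhd ℂ (f j) U)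
    (hW1 : ∃ t ∈ U,
      (Matrix.of fun i j : Fin n => iteratedDeriv (i : ℕ) (f j.castSucc) t).det ≠ 0)
    (hW2 : ∀ t ∈ U,
      (Matrix.of fun i j : Fin (n + 1) => iteratedDeriv (i : ℕ) (f j) t).det = 0) :
    ∃ c : Fin n → ℂ, ∀ t ∈ U, f (Fin.last n) t = ∑ j, c j * f j.castSucc t := by
  obtain ⟨t₀, ht₀, hdet₀⟩ := hW1
  have hd : ∀ (k : ℕ) (j : Fin (n + 1)), ∀ t ∈ U, DifferentiableAt ℂ (iteratedDeriv k (f j)) t :=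
    fun k j t ht => by
      rw [iteratedDeriv_eq_iterate]
      exact ((hf j).iterated_deriv k t ht).differentiableAt
  set M : ℂ → Matrix (Fin n) (Fin n) ℂ :=
    fun t => Matrix.of fun i j : Fin n => iteratedDeriv (i : ℕ) (f j.castSucc) t with hMdef
  set F : ℂ → Fin n → ℂ := fun t i => iteratedDeriv (i : ℕ) (f (Fin.last n)) t with hFdef
  have hMd : ∀ t ∈ U, ∀ i j, DifferentiableAt ℂ (fun s => M s i j) t :=
    fun t ht i j => hd i j.castSucc t ht
  set c : ℂ → Fin n → ℂ := fun t => ((M t).det)⁻¹ • (M t).cramer (F t) with hcdef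
  have hrel : ∀ t, (M t).det ≠ 0 → M t *ᵥ c t = F t := fun t ht => by
    rw [hcdef, Matrix.mulVec_smul, Matrix.mulVec_cramer, smul_smul, inv_mul_cancel₀ ht, one_smul]
  have hcd : ∀ t ∈ U, (M t).det ≠ 0 → ∀ j, DifferentiableAt ℂ (fun s => c s j) t := by
    intro t ht hdet j
    refine ((DifferentiableAt.matrix_det (hMd t ht)).inv hdet).mul ?_
    simp only [Matrix.cramer_apply]
    refine DifferentiableAt.matrix_det fun i k => ?_
    by_cases hk : k = j
    · subst hk
      simpa using hd i (Fin.last n) t ht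
    · simpa [Matrix.updateCol_ne hk] using hMd t ht i k
  have hnhds : ∀ᶠ t in nhds t₀, t ∈ U ∧ (M t).det ≠ 0 :=
    (hUo.eventually_mem ht₀).and
      ((DifferentiableAt.matrix_det (hMd t₀ ht₀)).continuousAt.eventually_ne hdet₀)
  obtain ⟨r, hr, hball⟩ := Metric.eventually_nhds_iff_ball.mp hnhds
  have hderiv : ∀ t ∈ Metric.ball t₀ r, ∀ j, deriv (fun s => c s j) t = 0 := by
    intro t ht
    obtain ⟨htU, hdet⟩ := hball t ht
    refine deriv_coeff_eq_zero (hMd t htU) (hcd t htU hdet) (F := F) ?_ ?_ hdet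
    · filter_upwards [Metric.isOpen_ball.mem_nhds ht] with s hs using hrel s (hball s hs).2
    · intro i
      have := Matrix.sum_mul_eq_last_of_det_eq_zero (hW2 t htU) hdet (c := c t)
        (fun i => congrFun (hrel t hdet) i) i.succ
      simpa [hMdef, hFdef, iteratedDeriv_succ] using this
  have hconst : ∀ t ∈ Metric.ball t₀ r, c t = c t₀ := fun t ht => funext fun j =>
    Metric.isOpen_ball.is_const_of_deriv_eq_zero (convex_ball t₀ r).isPreconnected
      (fun s hs => (hcd s (hball s hs).1 (hball s hs).2 j).differentiableWithinAt)
      (fun s hs => hderiv s hs j) ht (Metric.mem_ball_self hr)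
  refine ⟨c t₀, ?_⟩
  refine (hf _).eqOn_of_preconnected_of_eventuallyEq (g := fun t => ∑ j, c t₀ j * f j.castSucc t)
    (fun t ht => ?_) hUc ht₀ ?_
  · exact Finset.analyticAt_fun_sum _ fun j _ => analyticAt_const.mul (hf _ t ht)
  · filter_upwards [Metric.ball_mem_nhds t₀ hr] with t ht
    obtain ⟨htU, hdet⟩ := hball t ht
    have := Matrix.sum_mul_eq_last_of_det_eq_zero (hW2 t htU) hdet (c := c t)
      (fun i => congrFun (hrel t hdet) i) 0
    simpa [hconst t ht, mul_comm] using this.symm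


/-- If the Wronskian of `f₁, …, f_{a−1}` is not identically zero on a nonempty
connected open set `U ⊆ ℂ` while the Wronskian of `f₁, …, f_a` vanishes
identically on `U`, then `f_a` is a constant linear combination of
`f₁, …, f_{a−1}` on `U`. -/
theorem last_function_in_span_of_wronskians
    (U : Set ℂ) (hUo : IsOpen U) (hUc : IsConnected U)
    (a : ℕ) (ha : 2 ≤ a) (f : Fin a → ℂ → ℂ)
    (hf : ∀ j, AnalyticOnNhd ℂ (f j) U)
    (hW1 : ∃ t ∈ U,
      Matrix.det (Matrix.of fun i j : Fin (a - 1) =>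
        iteratedDeriv (i : ℕ) (f (Fin.castLE (Nat.sub_le a 1) j)) t) ≠ 0)
    (hW2 : ∀ t ∈ U,
      Matrix.det (Matrix.of fun i j : Fin a => iteratedDeriv (i : ℕ) (f j) t) = 0) :
    ∃ c : Fin (a - 1) → ℂ, ∀ t ∈ U,
      f ⟨a - 1, by omega⟩ t = ∑ j, c j * f (Fin.castLE (Nat.sub_le a 1) j) t := by
  obtain ⟨n, rfl⟩ : ∃ n, a = n + 1 := ⟨a - 1, by omega⟩
  exact exists_coeff_of_wronskian_eq_zero hUo hUc.isPreconnected hf hW1 hW2
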